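/- Let p be a partition of N with rows p₁ ≥ p₂ ≥ ⋯. Call a filling A of the Young diagram of p with complex numbers 'column strict' if entries strictly increase up each column in the partial order a ≤ b iff b − a ∈ ℤ_{≥0}. Let λ = (a₁,…,a_N) list the entries of A read along rows, arranged within each row so that whenever two entries a < b lie in the same row, a is to the left of b. Then A is row-equivalent to a column strict filling if and only if the Robinson–Schensted insertion tableau A(λ) (obtained by row-inserting a₁,…,a_N successively, using the order a < b iff b − a ∈ ℤ_{>0}) has shape p. -/

import Mathlib

noncomputable section

open scoped Classical

/-- The partial order on `ℂ`: `a < b` iff `b − a` is a positive integer. -/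
def cLt (a b : ℂ) : Prop := ∃ n : ℕ, b - a = (n : ℂ) + 1

noncomputable instance : DecidableEq ℂ := Classical.decEq ℂ

/-- Robinson–Schensted row insertion of `a` into a row: if no entry `b` of the row
satisfies `a < b`, append `a`; otherwise replace the smallest such `b` by `a` and
return the bumped entry `b`. -/
noncomputable def insertRow (a : ℂ) (row : List ℂ) : List ℂ × Option ℂ :=
  match (row.filter fun b => decide (cLt a b)).argmin (fun b => (b - a).re) with
  | none => (row ++ [a], none)
  | some b => (row.replace b a, some b)

/-- Robinson–Schensted insertion of `a` into a tableau, whose rows are listed from the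
(bottom) insertion row upwards; bumped entries are inserted into the next row up. -/
noncomputable def insertTab : ℂ → List (List ℂ) → List (List ℂ)
  | a, [] => [[a]]
  | a, row :: rest =>
    match insertRow a row with
    | (row', none) => row' :: rest
    | (row', some b) => row' :: insertTab b rest

/-- The Robinson–Schensted insertion tableau `A(λ)` of a list of complex numbers. -/
noncomputable def RSTab (l : List ℂ) : List (List ℂ) :=
  l.foldl (fun t a => insertTab a t) []

theorem cLt_irrefl (a : ℂ) : ¬ cLt a a := by
  rintro ⟨n, h⟩
  have : ((n + 1 : ℕ) : ℂ) = 0 := by push_cast; rw [← h]; ring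
  exact absurd (Nat.cast_eq_zero.mp this) (by omega)

theorem cLt_trans {a b c : ℂ} (h1 : cLt a b) (h2 : cLt b c) : cLt a c := by
  obtain ⟨n, h1⟩ := h1
  obtain ⟨m, h2⟩ := h2
  refine ⟨n + m + 1, ?_⟩
  push_cast
  linear_combination h1 + h2

theorem cLt_of_int {a b : ℂ} (n m : ℕ) (h : b - a = (n : ℂ) - m) :
    cLt a b ∨ a = b ∨ cLt b a := by
  rcases lt_trichotomy n m with h1 | h1 | h1
  · right; right
    obtain ⟨k, rfl⟩ := Nat.exists_eq_add_of_lt h1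
    refine ⟨k, ?_⟩
    push_cast at h
    linear_combination -h
  · right; left
    subst h1
    linear_combination -h
  · left
    obtain ⟨k, rfl⟩ := Nat.exists_eq_add_of_lt h1
    refine ⟨k, ?_⟩
    push_cast at h
    linear_combination h

theorem cLt_tri_right {a b c : ℂ} (h1 : cLt a b) (h2 : cLt a c) :
    cLt b c ∨ b = c ∨ cLt c b := by
  obtain ⟨n, h1⟩ := h1
  obtain ⟨m, h2⟩ := h2
  exact cLt_of_int m n (by linear_combination h2 - h1)

theorem cLt_tri_left {a b c : ℂ} (h1 : cLt b a) (h2 : cLt c a) :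
    cLt b c ∨ b = c ∨ cLt c b := by
  obtain ⟨n, h1⟩ := h1
  obtain ⟨m, h2⟩ := h2
  exact cLt_of_int n m (by linear_combination h1 - h2)

theorem cLt_re {a b : ℂ} (h : cLt a b) : a.re < b.re := by
  obtain ⟨n, h⟩ := h
  have := congrArg Complex.re h
  simp at this
  have h0 : (0 : ℝ) ≤ n := Nat.cast_nonneg n
  linarith

/-- weak order -/
def cLe (a b : ℂ) : Prop := cLt a b ∨ a = b

/-- `X` injects into `Y` along `r`. -/
def Dom (r : ℂ → ℂ → Prop) (X Y : Multiset ℂ) : Prop := ∃ Z ≤ Y, Multiset.Rel r X Z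

theorem Dom.nil (r : ℂ → ℂ → Prop) (Y : Multiset ℂ) : Dom r 0 Y :=
  ⟨0, Multiset.zero_le _, Multiset.Rel.zero⟩

theorem Dom.cons {r : ℂ → ℂ → Prop} {a b : ℂ} {X Y : Multiset ℂ} (h : r a b) (hd : Dom r X Y) :
    Dom r (a ::ₘ X) (b ::ₘ Y) := by
  obtain ⟨Z, hZ, hr⟩ := hd
  exact ⟨b ::ₘ Z, Multiset.cons_le_cons b hZ, Multiset.Rel.cons h hr⟩

theorem Dom.cons_left {r : ℂ → ℂ → Prop} {a : ℂ} {X Y : Multiset ℂ} (h : Dom r (a ::ₘ X) Y) :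
    ∃ y Y', Y = y ::ₘ Y' ∧ r a y ∧ Dom r X Y' := by
  obtain ⟨Z, hZ, hr⟩ := h
  obtain ⟨y, Z', hy, hr', rfl⟩ := Multiset.rel_cons_left.mp hr
  obtain ⟨D, rfl⟩ := Multiset.le_iff_exists_add.mp hZ
  exact ⟨y, Z' + D, by simp, hy, Z', Multiset.le_add_right _ _, hr'⟩

theorem Dom.mono_right {r : ℂ → ℂ → Prop} {X Y Y' : Multiset ℂ} (h : Dom r X Y) (hY : Y ≤ Y') :
    Dom r X Y' := by
  obtain ⟨Z, hZ, hr⟩ := h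
  exact ⟨Z, hZ.trans hY, hr⟩

theorem Dom.cons_right {r : ℂ → ℂ → Prop} {b : ℂ} {X Y : Multiset ℂ} (h : Dom r X (b ::ₘ Y)) :
    Dom r X Y ∨ ∃ x X', X = x ::ₘ X' ∧ r x b ∧ Dom r X' Y := by
  obtain ⟨Z, hZ, hr⟩ := h
  by_cases hb : b ∈ Z
  · right
    obtain ⟨Z', rfl⟩ := Multiset.exists_cons_of_mem hb
    obtain ⟨x, X', hx, hr', rfl⟩ := Multiset.rel_cons_right.mp hr
    exact ⟨x, X', rfl, hx, Z', (Multiset.cons_le_cons_iff b).mp hZ, hr'⟩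
  · left
    exact ⟨Z, (Multiset.le_cons_of_notMem hb).mp hZ, hr⟩

theorem Dom.change {r : ℂ → ℂ → Prop} {b d : ℂ} {X Y : Multiset ℂ} (h : Dom r X (b ::ₘ Y))
    (hbd : ∀ x ∈ X, r x b → r x d) : Dom r X (d ::ₘ Y) := by
  rcases h.cons_right with h | ⟨x, X', rfl, hx, h⟩
  · exact h.mono_right (Multiset.le_cons_self _ _)
  · exact Dom.cons (hbd x (by simp) hx) h

theorem Dom.comp {r s t : ℂ → ℂ → Prop} (hrs : ∀ a b c, r a b → s b c → t a c)
    {X Y Z : Multiset ℂ} (h1 : Dom r X Y) (h2 : Dom s Y Z) : Dom t X Z := by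
  induction X using Multiset.induction_on generalizing Y Z with
  | empty => exact Dom.nil _ _
  | cons a X ih =>
    obtain ⟨y, Y', rfl, hy, h1⟩ := h1.cons_left
    obtain ⟨z, Z', rfl, hz, h2⟩ := h2.cons_left
    exact Dom.cons (hrs _ _ _ hy hz) (ih h1 h2)

theorem Dom.add_left {r : ℂ → ℂ → Prop} (hr : ∀ a, r a a) {X Y : Multiset ℂ} (W : Multiset ℂ)
    (h : Dom r X Y) : Dom r (W + X) (W + Y) := by
  induction W using Multiset.induction_on with
  | empty => simpa using h
  | cons a W ih => simpa using Dom.cons (hr a) ih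

theorem lt_le_trans' (a b c : ℂ) (h1 : cLt a b) (h2 : cLe b c) : cLt a c := by
  rcases h2 with h2 | rfl
  · exact cLt_trans h1 h2
  · exact h1

theorem le_lt_trans' (a b c : ℂ) (h1 : cLe a b) (h2 : cLt b c) : cLt a c := by
  rcases h1 with h1 | rfl
  · exact cLt_trans h1 h2
  · exact h2

theorem le_le_trans' (a b c : ℂ) (h1 : cLe a b) (h2 : cLe b c) : cLe a c := by
  rcases h2 with h2 | rfl
  · exact Or.inl (le_lt_trans' _ _ _ h1 h2)
  · exact h1

/-- `a` bumps `b` from `b ::ₘ S`, giving `a ::ₘ S`. -/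
def Bump (a b : ℂ) (S : Multiset ℂ) : Prop := cLt a b ∧ ∀ c ∈ S, cLt a c → ¬ cLt c b

/-- Inserting the word into `R`, every letter bumps. -/
inductive Full : Multiset ℂ → List ℂ → List ℂ → Multiset ℂ → Prop
  | nil (R) : Full R [] [] R
  | cons {a b S w u R'} : Bump a b S → Full (a ::ₘ S) w u R' → Full (b ::ₘ S) (a :: w) (b :: u) R'

def OrdW (w : List ℂ) : Prop := w.Pairwise fun x y => ¬ cLt y x

theorem Full.dom {R w u R'} (h : Full R w u R') : Dom cLt (w : Multiset ℂ) (u : Multiset ℂ) := by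
  induction h with
  | nil => exact Dom.nil _ _
  | cons hb _ ih => exact Dom.cons hb.1 ih

theorem Full.length {R w u R'} (h : Full R w u R') : u.length = w.length := by
  induction h with
  | nil => rfl
  | cons hb _ ih => simp [ih]

theorem Bump.step {a b : ℂ} {S X w : Multiset ℂ} (hb : Bump a b S) (hX : X ≤ b ::ₘ S)
    (hd : Dom cLt (a ::ₘ w) X) : ∃ Y ≤ S, Dom cLt w Y ∧ Dom cLe (b ::ₘ Y) X := by
  obtain ⟨y, Y, rfl, hy, hd'⟩ := hd.cons_left
  have hby : cLe b y := by
    rcases Multiset.mem_cons.mp (Multiset.mem_of_le hX (Multiset.mem_cons_self y Y)) with h | h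
    · exact Or.inr h.symm
    · have := hb.2 y h hy
      rcases cLt_tri_right hb.1 hy with h | h | h
      · exact Or.inl h
      · exact Or.inr h
      · exact absurd h this
  have hrefl : ∀ Z, Dom cLe Z Z := fun Z =>
    ⟨_, le_refl _, Multiset.rel_refl_of_refl_on (fun x _ => Or.inr rfl)⟩
  by_cases hbX : b ∈ y ::ₘ Y
  · rcases Multiset.mem_cons.mp hbX with rfl | hbY
    · exact ⟨Y, (Multiset.cons_le_cons_iff _).mp hX, hd', hrefl _⟩
    · obtain ⟨Y, rfl⟩ := Multiset.exists_cons_of_mem hbY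
      rw [Multiset.cons_swap] at hX
      refine ⟨y ::ₘ Y, (Multiset.cons_le_cons_iff _).mp hX, ?_, ?_⟩
      · exact hd'.change fun x _ hx => lt_le_trans' _ _ _ hx hby
      · rw [Multiset.cons_swap]; exact hrefl _
  · have := (Multiset.le_cons_of_notMem hbX).mp hX
    exact ⟨Y, (Multiset.le_cons_self _ _).trans this, hd', Dom.cons hby (hrefl _)⟩

/-- minimality of the greedy bumps -/
theorem Full.minimal {R w u R'} (h : Full R w u R') :
    ∀ X ≤ R, Dom cLt (w : Multiset ℂ) X → Dom cLe (u : Multiset ℂ) X := by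
  induction h with
  | nil => intros; exact Dom.nil _ _
  | @cons a b S w u R' hb _ ih =>
    intro X hX hd
    obtain ⟨Y, h1, h2, h3⟩ := hb.step (w := (w : Multiset ℂ)) hX hd
    exact Dom.comp le_le_trans' (Dom.cons (Or.inr rfl)
      (ih Y (h1.trans (Multiset.le_cons_self _ _)) h2)) h3

theorem Full.maximal_aux {R w u R'} (h : Full R w u R') :
    ∀ X ≤ R', ∀ E, Dom cLt X ((u : Multiset ℂ) + E) →
      ∃ Y ≤ R, Dom cLt Y E ∧ Dom cLe X ((w : Multiset ℂ) + Y) := by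
  induction h with
  | nil R =>
    intro X hX E hd
    exact ⟨X, hX, by simpa using hd,
      by simpa using ⟨X, le_refl _, Multiset.rel_refl_of_refl_on (fun x _ => Or.inr rfl)⟩⟩
  | @cons a b S w u R' hb _ ih =>
    intro X hX E hd
    obtain ⟨Y, hY, hYE, hXY⟩ := ih X hX (b ::ₘ E) (by
      have : ((b :: u : List ℂ) : Multiset ℂ) + E = (u : Multiset ℂ) + b ::ₘ E := by
        rw [← Multiset.cons_coe]; simp only [Multiset.cons_add, Multiset.add_cons]
      rwa [this] at hd)
    have hle : ∀ x ∈ Y, cLt x b → cLe x a := by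
      intro x hx hxb
      rcases Multiset.mem_cons.mp (Multiset.mem_of_le hY hx) with h | h
      · exact Or.inr h
      · rcases cLt_tri_left hxb hb.1 with h' | h' | h'
        · exact Or.inl h'
        · exact Or.inr h'
        · exact absurd hxb (hb.2 x h h')
    have key : ∃ Y' ≤ b ::ₘ S, Dom cLt Y' E ∧ Dom cLe Y (a ::ₘ Y') := by
      by_cases ha : a ∈ Y
      · obtain ⟨Y', rfl⟩ := Multiset.exists_cons_of_mem ha
        have hY' := (Multiset.cons_le_cons_iff _).mp hY
        refine ⟨Y', hY'.trans (Multiset.le_cons_self _ _), ?_,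
          ⟨_, le_refl _, Multiset.rel_refl_of_refl_on (fun x _ => Or.inr rfl)⟩⟩
        obtain ⟨d, D, hD, had, hdom⟩ := hYE.cons_left
        rcases Multiset.cons_eq_cons.mp hD with ⟨rfl, rfl⟩ | ⟨_, D', rfl, rfl⟩
        · exact hdom
        · exact hdom.change fun x hx hxb =>
            le_lt_trans' _ _ _ (hle x (Multiset.mem_cons_of_mem hx) hxb) had
      · have hYS := (Multiset.le_cons_of_notMem ha).mp hY
        rcases hYE.cons_right with h | ⟨x, X', rfl, hx, h⟩
        · exact ⟨Y, hYS.trans (Multiset.le_cons_self _ _), h,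
            ⟨_, Multiset.le_cons_self _ _, Multiset.rel_refl_of_refl_on (fun x _ => Or.inr rfl)⟩⟩
        · exact ⟨X', ((Multiset.le_cons_self _ _).trans hYS).trans (Multiset.le_cons_self _ _), h,
            Dom.cons (hle x (by simp) hx) ⟨_, le_refl _, Multiset.rel_refl_of_refl_on (fun x _ => Or.inr rfl)⟩⟩
    obtain ⟨Y', h1, h2, h3⟩ := key
    refine ⟨Y', h1, h2, ?_⟩
    have := Dom.comp le_le_trans' hXY (Dom.add_left (fun a => Or.inr rfl) (w : Multiset ℂ) h3)
    rw [← Multiset.cons_coe]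
    simpa only [Multiset.cons_add, Multiset.add_cons] using this

theorem Full.maximal {R w u R'} (h : Full R w u R') (X) (hX : X ≤ R')
    (hd : Dom cLt X (u : Multiset ℂ)) : Dom cLe X (w : Multiset ℂ) := by
  obtain ⟨Y, _, hY, hXY⟩ := h.maximal_aux X hX 0 (by simpa using hd)
  obtain ⟨Z, hZ, hr⟩ := hY
  have : Z = 0 := by simpa using hZ
  subst this
  have : Y = 0 := by simpa using hr
  subst this
  simpa using hXY

theorem Full.struct {R w u R'} (h : Full R w u R') :
    ∀ Q I, R = Q + I → OrdW w → (∀ i ∈ I, ∀ x ∈ w, ¬ cLt x i) →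
      ∃ S, Q = S + (u : Multiset ℂ) ∧ R' = S + (w : Multiset ℂ) + I := by
  induction h with
  | nil R =>
    intro Q I h _ _
    exact ⟨Q, by simp, by simpa using h⟩
  | @cons a b S w u R' hb _ ih =>
    intro Q I h ho hI
    have hbI : b ∉ I := fun h => hI b h a (by simp) hb.1
    have hbQ : b ∈ Q := by
      have : b ∈ Q + I := h ▸ Multiset.mem_cons_self _ _
      rcases Multiset.mem_add.mp this with h | h
      · exact h
      · exact absurd h hbI
    obtain ⟨Q', rfl⟩ := Multiset.exists_cons_of_mem hbQ
    have hS : S = Q' + I := by simpa using h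
    have ho' := List.pairwise_cons.mp ho
    obtain ⟨S', h1, h2⟩ := ih Q' (a ::ₘ I) (by simp [hS]) ho'.2 (by
      intro i hi x hx
      rcases Multiset.mem_cons.mp hi with rfl | hi
      · exact ho'.1 x hx
      · exact hI i hi x (by simp [hx]))
    refine ⟨S', ?_, ?_⟩
    · rw [← Multiset.cons_coe, h1]; simp only [Multiset.cons_add, Multiset.add_cons]
    · rw [← Multiset.cons_coe, h2]; simp only [Multiset.cons_add, Multiset.add_cons]

theorem Full.bumped_le {R w u R'} (h : Full R w u R') (ho : OrdW w) : (u : Multiset ℂ) ≤ R := by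
  obtain ⟨S, h1, _⟩ := h.struct R 0 (by simp) ho (by simp)
  rw [h1]; exact Multiset.le_add_left _ _

theorem Full.word_le {R w u R'} (h : Full R w u R') (ho : OrdW w) : (w : Multiset ℂ) ≤ R' := by
  obtain ⟨S, _, h1⟩ := h.struct R 0 (by simp) ho (by simp)
  rw [h1]; simp

theorem Full.not_lt {R w u R'} (h : Full R w u R') (b : ℂ) :
    OrdW w → (∀ c ∈ R, cLt c b → ∀ x ∈ w, ¬ cLt x c) → ∀ y ∈ u, ¬ cLt y b := by
  induction h with
  | nil R => simp
  | @cons a b' S w u R' hb _ ih =>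
    intro ho hR y hy hyb
    have ho' := List.pairwise_cons.mp ho
    rcases List.mem_cons.mp hy with rfl | hy
    · exact hR y (by simp) hyb a (by simp) hb.1
    · refine ih ho'.2 ?_ y hy hyb
      intro c hc hcb x hx
      rcases Multiset.mem_cons.mp hc with rfl | hc
      · exact ho'.1 x hx
      · exact hR c (by simp [hc]) hcb x (by simp [hx])

theorem Full.ord {R w u R'} (h : Full R w u R') : OrdW w → OrdW u := by
  induction h with
  | nil R => exact id
  | @cons a b S w u R' hb hf ih =>
    intro ho
    have ho' := List.pairwise_cons.mp ho
    refine List.pairwise_cons.mpr ⟨?_, ih ho'.2⟩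
    refine hf.not_lt b ho'.2 ?_
    intro c hc hcb x hx hxc
    rcases Multiset.mem_cons.mp hc with rfl | hc
    · exact ho'.1 x hx hxc
    · rcases cLt_tri_left hcb hb.1 with h | h | h
      · exact ho'.1 x hx (cLt_trans hxc h)
      · exact ho'.1 x hx (h ▸ hxc)
      · exact hb.2 c hc h hcb

/-- The key two step lemma. -/
theorem Full.two {R v u R' w u' R''} (h : Full R v u R') (hv : OrdW v)
    (h' : Full R' w u' R'') (hw : OrdW w) :
    Dom cLt (w : Multiset ℂ) v ↔ Dom cLt (u' : Multiset ℂ) u := by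
  constructor
  · intro hd
    exact Dom.comp le_lt_trans' (h'.minimal v (h.word_le hv) hd) h.dom
  · intro hd
    exact Dom.comp lt_le_trans' h'.dom (h.maximal u' (h'.bumped_le hw) hd)

theorem replace_spec (l : List ℂ) (b a : ℂ) (h : b ∈ l) :
    ∃ S : Multiset ℂ, (l : Multiset ℂ) = b ::ₘ S ∧ ((l.replace b a : List ℂ) : Multiset ℂ) = a ::ₘ S := by
  induction l with
  | nil => simp at h
  | cons x l ih =>
    by_cases hx : x = b
    · subst hx
      exact ⟨l, rfl, by simp⟩
    · have hb : b ∈ l := by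
        rcases List.mem_cons.mp h with h | h
        · exact absurd h.symm hx
        · exact h
      obtain ⟨S, h1, h2⟩ := ih hb
      refine ⟨x ::ₘ S, ?_, ?_⟩
      · rw [← Multiset.cons_coe, h1, Multiset.cons_swap]
      · have : (x :: l).replace b a = x :: l.replace b a := by
          rw [List.replace_cons]
          have : (b == x) = false := by simpa using fun h => hx h.symm
          simp [this]
        rw [this, ← Multiset.cons_coe, h2, Multiset.cons_swap]

theorem insertRow_spec (a : ℂ) (row : List ℂ) :
    (insertRow a row = (row ++ [a], none) ∧ ∀ b ∈ row, ¬ cLt a b) ∨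
    ∃ (b : ℂ) (row' : List ℂ) (S : Multiset ℂ), insertRow a row = (row', some b) ∧
      (row : Multiset ℂ) = b ::ₘ S ∧ (row' : Multiset ℂ) = a ::ₘ S ∧ Bump a b S := by
  rcases h : (row.filter fun b => decide (cLt a b)).argmin (fun b => (b - a).re) with _ | b
  · left
    refine ⟨by simp only [insertRow, h], ?_⟩
    have := List.argmin_eq_none.mp h
    intro b hb hab
    have hm : b ∈ row.filter fun b => decide (cLt a b) := by simp [hb, hab]
    rw [this] at hm
    simp at hm
  · right
    have hm := List.argmin_mem h
    simp only [List.mem_filter, decide_eq_true_eq] at hm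
    obtain ⟨S, h1, h2⟩ := replace_spec row b a hm.1
    refine ⟨b, row.replace b a, S, by simp only [insertRow, h], h1, h2, hm.2, ?_⟩
    intro c hc hac hcb
    have hc' : c ∈ row := by
      have : c ∈ (row : Multiset ℂ) := by rw [h1]; simp [hc]
      simpa using this
    have hle := List.le_of_mem_argmin (a := c) (by simp [hc', hac]) h
    have := cLt_re hcb
    simp at hle
    linarith

/-- Insert a word into a row: final row and bumped word. -/
def insList : List ℂ → List ℂ → List ℂ × List ℂ
  | R, [] => (R, [])
  | R, a :: w => ((insList (insertRow a R).1 w).1,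
      (insertRow a R).2.toList ++ (insList (insertRow a R).1 w).2)

theorem insList_append (R w w' : List ℂ) :
    insList R (w ++ w') = ((insList (insList R w).1 w').1,
      (insList R w).2 ++ (insList (insList R w).1 w').2) := by
  induction w generalizing R with
  | nil => simp [insList]
  | cons a w ih => simp [insList, ih]

theorem foldl_insertTab (row : List ℂ) (rest : List (List ℂ)) (w : List ℂ) :
    w.foldl (fun t a => insertTab a t) (row :: rest) =
      (insList row w).1 :: (insList row w).2.foldl (fun t a => insertTab a t) rest := by
  induction w generalizing row rest with
  | nil => simp [insList]
  | cons a w ih =>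
    rcases h : insertRow a row with ⟨row', _ | b⟩
    · simp [insList, insertTab, h, ih]
    · simp [insList, insertTab, h, ih]

theorem insList_length (R w : List ℂ) :
    (insList R w).1.length + (insList R w).2.length = R.length + w.length ∧
      (insList R w).2.length ≤ w.length := by
  induction w generalizing R with
  | nil => simp [insList]
  | cons a w ih =>
    rcases insertRow_spec a R with ⟨h, _⟩ | ⟨b, R', S, h, h1, h2, _⟩
    · have := ih (R ++ [a])
      simp [insList, h] at this ⊢
      omega
    · have := ih R'
      have h1' := congrArg Multiset.card h1
      have h2' := congrArg Multiset.card h2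
      simp [insList, h] at this h1' h2' ⊢
      omega

theorem insList_full (R w : List ℂ) (hl : (insList R w).2.length = w.length) :
    Full R w (insList R w).2 (insList R w).1 := by
  induction w generalizing R with
  | nil => exact Full.nil _
  | cons a w ih =>
    rcases insertRow_spec a R with ⟨h, _⟩ | ⟨b, R', S, h, h1, h2, hb⟩
    · have := (insList_length (R ++ [a]) w).2
      simp [insList, h] at hl
      omega
    · simp only [insList, h] at hl ⊢
      have := ih R' (by simpa using hl)
      rw [h2] at this
      rw [h1]
      exact Full.cons hb this

theorem insList_of_dom (R w : List ℂ) (X : Multiset ℂ) (hX : X ≤ R)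
    (hd : Dom cLt (w : Multiset ℂ) X) : (insList R w).2.length = w.length := by
  induction w generalizing R X with
  | nil => simp [insList]
  | cons a w ih =>
    rcases insertRow_spec a R with ⟨h, h'⟩ | ⟨b, R', S, h, h1, h2, hb⟩
    · obtain ⟨y, Y, rfl, hy, _⟩ := Dom.cons_left (a := a) (X := (w : Multiset ℂ)) hd
      have := Multiset.mem_of_le hX (Multiset.mem_cons_self y Y)
      exact absurd hy (h' y (by simpa using this))
    · obtain ⟨Y, h3, h4, _⟩ := hb.step (w := (w : Multiset ℂ)) (h1 ▸ hX) hd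
      have := ih R' Y (by rw [h2]; exact h3.trans (Multiset.le_cons_self _ _)) h4
      simp [insList, h, this]

def bumps : List ℂ → List (List ℂ) → List (List ℂ)
  | _, [] => []
  | R, w :: W => (insList R w).2 :: bumps (insList R w).1 W

theorem bumps_flatten (R : List ℂ) (W : List (List ℂ)) :
    (insList R W.flatten).2 = (bumps R W).flatten := by
  induction W generalizing R with
  | nil => simp [insList, bumps]
  | cons w W ih => simp [bumps, insList_append, ih]

theorem bumps_full (R : List ℂ) (W : List (List ℂ))
    (h : (insList R W.flatten).1.length = R.length) :
    (bumps R W).map List.length = W.map List.length := by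
  induction W generalizing R with
  | nil => simp [bumps]
  | cons w W ih =>
    simp only [List.flatten_cons, insList_append] at h
    have h1 := insList_length R w
    have h2 := insList_length (insList R w).1 W.flatten
    have := ih (insList R w).1 (by omega)
    simp [bumps, this]
    omega

theorem full_of_bumps (R : List ℂ) (W : List (List ℂ))
    (h : (bumps R W).map List.length = W.map List.length) :
    (insList R W.flatten).1.length = R.length := by
  have h1 := insList_length R W.flatten
  rw [bumps_flatten, List.length_flatten, List.length_flatten, h] at h1
  omega

/-- adjacency relation -/
def Adj (x y : List ℂ) : Prop := Dom cLt (y : Multiset ℂ) (x : Multiset ℂ)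

theorem chain_iff (W : List (List ℂ)) : ∀ (R : Multiset ℂ) (v u R' : List ℂ),
    Full R v u R' → OrdW v → (∀ w ∈ W, OrdW w) →
    (List.IsChain Adj (v :: W) ↔
      (bumps R' W).map List.length = W.map List.length ∧ List.IsChain Adj (u :: bumps R' W)) := by
  induction W with
  | nil => intros; simp [bumps]
  | cons w W ih =>
    intro R v u R' hf hv hW
    have hw : OrdW w := hW w (by simp)
    have hW' : ∀ w ∈ W, OrdW w := fun x hx => hW x (by simp [hx])
    simp only [bumps, List.isChain_cons_cons, List.map_cons, List.cons.injEq]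
    constructor
    · rintro ⟨h1, h2⟩
      have hl := insList_of_dom R' w v (hf.word_le hv) h1
      have hf' := insList_full R' w hl
      obtain ⟨h3, h4⟩ := (ih _ _ _ _ hf' hw hW').mp h2
      exact ⟨⟨hl, h3⟩, (hf.two hv hf' hw).mp h1, h4⟩
    · rintro ⟨⟨hl, h3⟩, h1, h4⟩
      have hf' := insList_full R' w hl
      exact ⟨(hf.two hv hf' hw).mpr h1, (ih _ _ _ _ hf' hw hW').mpr ⟨h3, h4⟩⟩

theorem chain_iff_top (W : List (List ℂ)) (v : List ℂ) (hW : ∀ w ∈ W, OrdW w) :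
    List.IsChain Adj (v :: W) ↔
      (bumps v W).map List.length = W.map List.length ∧ List.IsChain Adj (bumps v W) := by
  cases W with
  | nil => simp [bumps]
  | cons w W =>
    have hw : OrdW w := hW w (by simp)
    have hW' : ∀ w ∈ W, OrdW w := fun x hx => hW x (by simp [hx])
    simp only [bumps, List.isChain_cons_cons, List.map_cons, List.cons.injEq]
    constructor
    · rintro ⟨h1, h2⟩
      have hl := insList_of_dom v w v le_rfl h1
      have hf' := insList_full v w hl
      obtain ⟨h3, h4⟩ := (chain_iff W _ _ _ _ hf' hw hW').mp h2
      exact ⟨⟨hl, h3⟩, h4⟩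
    · rintro ⟨⟨hl, h3⟩, h4⟩
      have hf' := insList_full v w hl
      exact ⟨hf'.dom.mono_right (hf'.bumped_le hw), (chain_iff W _ _ _ _ hf' hw hW').mpr ⟨h3, h4⟩⟩

theorem bumps_ord (W : List (List ℂ)) : ∀ R : List ℂ, (∀ w ∈ W, OrdW w) →
    (bumps R W).map List.length = W.map List.length → ∀ u ∈ bumps R W, OrdW u := by
  induction W with
  | nil => simp [bumps]
  | cons w W ih =>
    intro R hW hl u hu
    simp only [bumps, List.map_cons, List.cons.injEq] at hl
    rcases List.mem_cons.mp hu with rfl | hu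
    · exact (insList_full R w hl.1).ord (hW w (by simp))
    · exact ih _ (fun x hx => hW x (by simp [hx])) hl.2 u hu

theorem insList_ord (R w : List ℂ) (h : OrdW (R ++ w)) : insList R w = (R ++ w, []) := by
  induction w generalizing R with
  | nil => simp [insList]
  | cons a w ih =>
    rcases insertRow_spec a R with ⟨h', _⟩ | ⟨b, R', S, _, h1, _, hb⟩
    · have := ih (R ++ [a]) (by simpa using h)
      simp [insList, h', this]
    · exfalso
      have hbR : b ∈ R := by
        have : b ∈ (R : Multiset ℂ) := by rw [h1]; simp
        simpa using this
      exact (List.pairwise_append.mp h).2.2 b hbR a (by simp) hb.1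

theorem RSTab_cons (w : List ℂ) (W : List (List ℂ)) (hne : w ≠ []) (ho : OrdW w) :
    RSTab (w :: W).flatten = (insList w W.flatten).1 :: RSTab (bumps w W).flatten := by
  have h0 : RSTab (w :: W).flatten =
      ((w :: W).flatten).foldl (fun t a => insertTab a t) [[]] := by
    cases w with
    | nil => exact absurd rfl hne
    | cons a w =>
      simp [RSTab, insertTab, insertRow]
  rw [h0, foldl_insertTab, List.flatten_cons, insList_append, insList_ord [] w (by simpa using ho)]
  simp [RSTab, bumps_flatten]

theorem main_list (k : ℕ) : ∀ W : List (List ℂ), W.length = k → (∀ w ∈ W, OrdW w) →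
    (∀ w ∈ W, 0 < w.length) →
    (List.IsChain Adj W ↔ (RSTab W.flatten).map List.length = W.map List.length) := by
  induction k with
  | zero =>
    intro W hW _ _
    rw [List.length_eq_zero_iff] at hW
    subst hW
    simp [RSTab]
  | succ k ih =>
    intro W hk ho hp
    cases W with
    | nil => simp at hk
    | cons w W =>
      have ho' : ∀ w ∈ W, OrdW w := fun x hx => ho x (by simp [hx])
      have hl : (bumps w W).map List.length = W.map List.length →
          (List.IsChain Adj (bumps w W) ↔
            (RSTab (bumps w W).flatten).map List.length = (bumps w W).map List.length) := by
        intro hl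
        refine ih _ ?_ (bumps_ord W w ho' hl) ?_
        · have := congrArg List.length hl
          simp at this hk
          omega
        · intro u hu
          have : u.length ∈ W.map List.length := hl ▸ List.mem_map_of_mem hu
          obtain ⟨x, hx, hxu⟩ := List.mem_map.mp this
          rw [← hxu]
          exact hp x (by simp [hx])
      have hne : w ≠ [] := List.length_pos_iff.mp (hp w (by simp))
      rw [RSTab_cons w W hne (ho w (by simp)), chain_iff_top W w ho', List.map_cons, List.map_cons,
        List.cons.injEq]
      constructor
      · rintro ⟨h1, h2⟩
        exact ⟨full_of_bumps w W h1, ((hl h1).mp h2).trans h1⟩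
      · rintro ⟨h1, h2⟩
        have h3 := bumps_full w W h1
        exact ⟨h3, (hl h3).mpr (h2.trans h3.symm)⟩

/-! Translation to functions on `Fin`. -/

theorem dom_to_inj {ι κ : Type} [DecidableEq ι] [DecidableEq κ] [Nonempty κ]
    (r : ℂ → ℂ → Prop) (f : ι → ℂ) (g : κ → ℂ) (s : Finset ι) : ∀ t : Finset κ,
    Dom r (s.val.map f) (t.val.map g) →
    ∃ φ : ι → κ, Set.InjOn φ s ∧ ∀ i ∈ s, φ i ∈ t ∧ r (f i) (g (φ i)) := by
  induction s using Finset.induction_on with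
  | empty => intro t _; exact ⟨fun _ => Classical.arbitrary κ, by simp, by simp⟩
  | insert i s hi ih =>
    intro t h
    rw [Finset.insert_val_of_notMem hi, Multiset.map_cons] at h
    obtain ⟨y, Y, hY, hy, hd⟩ := h.cons_left
    have : y ∈ t.val.map g := by rw [hY]; simp
    obtain ⟨k, hk, rfl⟩ := Multiset.mem_map.mp this
    have hk' : k ∈ t := hk
    have hYe : Y = (t.erase k).val.map g := by
      have h1 : t.val = k ::ₘ (t.erase k).val := by
        rw [Finset.erase_val, Multiset.cons_erase hk]
      rw [h1, Multiset.map_cons] at hY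
      exact ((Multiset.cons_inj_right _).mp hY).symm
    rw [hYe] at hd
    obtain ⟨φ, h1, h2⟩ := ih _ hd
    have hne : ∀ j ∈ s, j ≠ i := fun j hj h => hi (h ▸ hj)
    refine ⟨Function.update φ i k, ?_, ?_⟩
    · intro a ha b hb hab
      simp only [Finset.coe_insert, Set.mem_insert_iff, Finset.mem_coe] at ha hb
      rcases ha with rfl | ha <;> rcases hb with rfl | hb
      · rfl
      · rw [Function.update_self, Function.update_of_ne (hne b hb)] at hab
        exact absurd hab.symm (Finset.mem_erase.mp (h2 b hb).1).1
      · rw [Function.update_self, Function.update_of_ne (hne a ha)] at hab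
        exact absurd hab (Finset.mem_erase.mp (h2 a ha).1).1
      · rw [Function.update_of_ne (hne a ha), Function.update_of_ne (hne b hb)] at hab
        exact h1 ha hb hab
    · intro j hj
      rcases Finset.mem_insert.mp hj with rfl | hj
      · rw [Function.update_self]; exact ⟨hk', hy⟩
      · rw [Function.update_of_ne (hne j hj)]
        exact ⟨Finset.mem_of_mem_erase (h2 j hj).1, (h2 j hj).2⟩

theorem dom_iff_inj {m n : ℕ} (hn : 0 < n) (r : ℂ → ℂ → Prop) (f : Fin m → ℂ) (g : Fin n → ℂ) :
    Dom r ((List.ofFn f : List ℂ) : Multiset ℂ) ((List.ofFn g : List ℂ) : Multiset ℂ) ↔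
      ∃ φ : Fin m → Fin n, Function.Injective φ ∧ ∀ i, r (f i) (g (φ i)) := by
  have e : ∀ {l : ℕ} (h : Fin l → ℂ), ((List.ofFn h : List ℂ) : Multiset ℂ) =
      (Finset.univ : Finset (Fin l)).val.map h := by
    intro l h
    rw [Fin.univ_val_map]
  rw [e, e]
  constructor
  · intro h
    haveI : Nonempty (Fin n) := ⟨⟨0, hn⟩⟩
    obtain ⟨φ, h1, h2⟩ := dom_to_inj r f g _ _ h
    exact ⟨φ, fun a b hab => h1 (by simp) (by simp) hab, fun i => (h2 i (by simp)).2⟩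
  · rintro ⟨φ, h1, h2⟩
    refine ⟨(Finset.univ.map ⟨φ, h1⟩).val.map g,
      Multiset.map_le_map (Finset.val_le_iff.mpr (Finset.subset_univ _)), ?_⟩
    rw [Finset.map_val, Multiset.map_map, Multiset.rel_map]
    exact Multiset.rel_refl_of_refl_on fun i _ => h2 i

theorem extend_perm {m n : ℕ} (h : m ≤ n) (φ : Fin m → Fin n) (hφ : Function.Injective φ) :
    ∃ τ : Equiv.Perm (Fin n), ∀ j : Fin m, τ (Fin.castLE h j) = φ j := by
  let e : {x // x ∈ Set.range (Fin.castLE h)} ≃ {x // x ∈ Set.range φ} :=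
    (Equiv.ofInjective _ (Fin.castLE_injective h)).symm.trans (Equiv.ofInjective φ hφ)
  refine ⟨e.extendSubtype, fun j => ?_⟩
  rw [Equiv.extendSubtype_apply_of_mem e _ ⟨j, rfl⟩]
  have : (⟨Fin.castLE h j, ⟨j, rfl⟩⟩ : {x // x ∈ Set.range (Fin.castLE h)}) =
    Equiv.ofInjective _ (Fin.castLE_injective h) j := rfl
  simp only [e, Equiv.trans_apply, this, Equiv.symm_apply_apply]
  rfl

theorem build_tau (n : ℕ) : ∀ (p : Fin n → ℕ)
    (_ : ∀ i j : Fin n, i ≤ j → p j ≤ p i) (T : (i : Fin n) → Fin (p i) → ℂ)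
    (_ : ∀ i₁ i₂ : Fin n, (i₂ : ℕ) = (i₁ : ℕ) + 1 →
      ∃ φ : Fin (p i₂) → Fin (p i₁), Function.Injective φ ∧ ∀ j, cLt (T i₂ j) (T i₁ (φ j))),
    ∃ τ : (i : Fin n) → Equiv.Perm (Fin (p i)),
        ∀ (i₁ i₂ : Fin n) (j₁ : Fin (p i₁)) (j₂ : Fin (p i₂)),
          (i₂ : ℕ) = (i₁ : ℕ) + 1 → (j₁ : ℕ) = (j₂ : ℕ) →
          cLt (T i₂ (τ i₂ j₂)) (T i₁ (τ i₁ j₁)) := by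
  induction n with
  | zero => intro p _ T _; exact ⟨fun i => i.elim0, fun i => i.elim0⟩
  | succ n ih =>
    intro p hm T H
    obtain ⟨τ', hτ'⟩ := ih (fun i => p i.succ) (fun i j h => hm _ _ (Fin.succ_le_succ_iff.mpr h))
      (fun i => T i.succ) (fun i₁ i₂ h => H i₁.succ i₂.succ (by simp [h]))
    have h0 : ∃ τ₀ : Equiv.Perm (Fin (p 0)), ∀ (i : Fin n) (j₁ : Fin (p 0)) (j₂ : Fin (p i.succ)),
        (i : ℕ) = 0 → (j₁ : ℕ) = (j₂ : ℕ) → cLt (T i.succ (τ' i j₂)) (T 0 (τ₀ j₁)) := by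
      cases n with
      | zero => exact ⟨1, fun i => i.elim0⟩
      | succ n =>
        obtain ⟨φ, h1, h2⟩ := H 0 (Fin.succ 0) (by simp)
        obtain ⟨τ₀, h3⟩ := extend_perm (hm 0 (Fin.succ 0) (Fin.zero_le _)) (fun j => φ (τ' 0 j))
          (h1.comp (τ' 0).injective)
        refine ⟨τ₀, fun i j₁ j₂ hi hj => ?_⟩
        obtain rfl : i = 0 := Fin.ext hi
        have : j₁ = Fin.castLE (hm 0 (Fin.succ 0) (Fin.zero_le _)) j₂ := Fin.ext hj
        rw [this, h3]
        exact h2 _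
    obtain ⟨τ₀, h0⟩ := h0
    refine ⟨Fin.cons (α := fun i => Equiv.Perm (Fin (p i))) τ₀ τ', ?_⟩
    intro i₁ i₂
    refine Fin.cases ?_ (fun i₂ => ?_) i₂
    · intro _ _ h; simp at h
    · refine Fin.cases ?_ (fun i₁ => ?_) i₁
      · intro j₁ j₂ h hj
        exact h0 i₂ j₁ j₂ (by simpa using h) hj
      · intro j₁ j₂ h hj
        exact hτ' i₁ i₂ j₁ j₂ (by simpa using h) hj

/-- let `p` be a partition of `N` (rows `p 0 ≥ p 1 ≥ ⋯`), `T` a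
`p`-tableau with complex entries, and `σ` a rearrangement of each row such that
whenever two entries `a < b` lie in the same row, `a` is to the left of `b`.  Let
`λ` be the word reading the rearranged rows in order.  Then `T` is row-equivalent to
a column strict tableau (entries strictly increasing up each column) if and only if
the Robinson–Schensted insertion tableau of `λ` has shape `p`. -/
theorem stmt_11 (n N : ℕ) (p : Fin n → ℕ)
    (hpos : ∀ i, 0 < p i)
    (hmono : ∀ i j : Fin n, i ≤ j → p j ≤ p i)
    (hN : ∑ i, p i = N)
    (T : (i : Fin n) → Fin (p i) → ℂ)
    (σ : (i : Fin n) → Equiv.Perm (Fin (p i)))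
    (hσ : ∀ (i : Fin n) (j j' : Fin (p i)), cLt (T i (σ i j)) (T i (σ i j')) → j < j') :
    ((∃ τ : (i : Fin n) → Equiv.Perm (Fin (p i)),
        ∀ (i₁ i₂ : Fin n) (j₁ : Fin (p i₁)) (j₂ : Fin (p i₂)),
          (i₂ : ℕ) = (i₁ : ℕ) + 1 → (j₁ : ℕ) = (j₂ : ℕ) →
          cLt (T i₂ (τ i₂ j₂)) (T i₁ (τ i₁ j₁)))
      ↔ (RSTab ((List.ofFn fun i => List.ofFn fun j => T i (σ i j)).flatten)).map
          List.length = List.ofFn p) := by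
  have ho : ∀ w ∈ (List.ofFn fun i => List.ofFn fun j => T i (σ i j)), OrdW w := by
    intro w hw
    obtain ⟨i, rfl⟩ := (List.mem_ofFn' _ _).mp hw
    refine List.pairwise_ofFn.mpr fun j j' hjj' h => ?_
    exact absurd (hσ i j' j h) (not_lt.mpr hjj'.le)
  have hp : ∀ w ∈ (List.ofFn fun i => List.ofFn fun j => T i (σ i j)), 0 < w.length := by
    intro w hw
    obtain ⟨i, rfl⟩ := (List.mem_ofFn' _ _).mp hw
    simpa using hpos i
  have hlen : (List.ofFn fun i => List.ofFn fun j => T i (σ i j)).map List.length = List.ofFn p := by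
    rw [List.map_ofFn]
    congr 1
    funext i
    simp
  rw [← hlen, ← main_list _ _ rfl ho hp, List.isChain_iff_getElem]
  have hrow : ∀ i₁ i₂ : Fin n, Adj (List.ofFn fun j => T i₁ (σ i₁ j)) (List.ofFn fun j => T i₂ (σ i₂ j)) ↔
      ∃ φ : Fin (p i₂) → Fin (p i₁), Function.Injective φ ∧ ∀ j, cLt (T i₂ j) (T i₁ (φ j)) := by
    intro i₁ i₂
    unfold Adj
    rw [dom_iff_inj (hpos i₁)]
    constructor
    · rintro ⟨φ, h1, h2⟩
      refine ⟨fun j => σ i₁ (φ ((σ i₂).symm j)),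
        (σ i₁).injective.comp (h1.comp (σ i₂).symm.injective), fun j => ?_⟩
      simpa using h2 ((σ i₂).symm j)
    · rintro ⟨φ, h1, h2⟩
      refine ⟨fun j => (σ i₁).symm (φ (σ i₂ j)),
        (σ i₁).symm.injective.comp (h1.comp (σ i₂).injective), fun j => ?_⟩
      simpa using h2 (σ i₂ j)
  constructor
  · rintro ⟨τ, hτ⟩ i hi
    simp only [List.length_ofFn] at hi
    simp only [List.getElem_ofFn]
    rw [hrow]
    have hle : p ⟨i + 1, hi⟩ ≤ p ⟨i, by omega⟩ := hmono _ _ (by simp [Fin.le_def])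
    refine ⟨fun j => τ _ (Fin.castLE hle ((τ ⟨i + 1, hi⟩).symm j)),
      (τ _).injective.comp ((Fin.castLE_injective hle).comp (τ _).symm.injective), fun j => ?_⟩
    simpa using hτ ⟨i, by omega⟩ ⟨i + 1, hi⟩ (Fin.castLE hle ((τ ⟨i + 1, hi⟩).symm j))
      ((τ ⟨i + 1, hi⟩).symm j) rfl rfl
  · intro H
    refine build_tau n p hmono T ?_
    rintro ⟨i₁, h₁⟩ ⟨i₂, h₂⟩ h
    simp only at h
    subst h
    have := H i₁ (by simpa using h₂)
    simp only [List.getElem_ofFn] at this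
    exact (hrow _ _).mp this
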